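/- (Hopf-type boundary point lemma for a first eigenfunction.) Let 1 < p < ∞, λ > 0, and let Ω ⊂ ℝ^N be a bounded open set. Let y be C^1 on the closure of Ω, y > 0 in Ω, and a weak solution of −Δ_p y = λ y^{p−1} in Ω. Suppose B(z0, R) ⊆ Ω and x0 ∈ ∂B(z0,R) ∩ ∂Ω with y(x0) = 0. Then ⟨∇y(x0), (x0 − z0)/R⟩ < 0. -/

import Mathlib

open MeasureTheory RealInnerProductSpace Metric Set

noncomputable section

/-- Smooth test functions compactly supported in `U` (the class `C_c^∞(U)`). -/
def IsTestFun {N : ℕ} (U : Set (EuclideanSpace ℝ (Fin N)))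
    (φ : EuclideanSpace ℝ (Fin N) → ℝ) : Prop :=
  ContDiff ℝ (⊤ : ℕ∞) φ ∧ HasCompactSupport φ ∧ tsupport φ ⊆ U

/-- `u` is a weak solution of `-Δ_p u = h` in `U`:
`∫_U |∇u|^{p-2} ⟨∇u, ∇φ⟩ = ∫_U h φ` for all test functions `φ`. -/
def IsWeakSolution (p : ℝ) {N : ℕ} (U : Set (EuclideanSpace ℝ (Fin N)))
    (u h : EuclideanSpace ℝ (Fin N) → ℝ) : Prop :=
  ∀ φ : EuclideanSpace ℝ (Fin N) → ℝ, IsTestFun U φ →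
    (∫ x in U, ‖gradient u x‖ ^ (p - 2) * ⟪gradient u x, gradient φ x⟫)
      = ∫ x in U, h x * φ x

/-- The `p`-torsional rigidity of `U`:
`E(U) = (p/(p-1)) ⬝ sup { ∫_U φ - (1/p) ∫_U |∇φ|^p : φ ∈ C_c^∞(U) }`. -/
def pTorsionalRigidity (p : ℝ) {N : ℕ} (U : Set (EuclideanSpace ℝ (Fin N))) : ℝ :=
  (p / (p - 1)) *
    sSup { r : ℝ | ∃ φ, IsTestFun U φ ∧
      r = (∫ x in U, φ x) - (1 / p) * ∫ x in U, ‖gradient φ x‖ ^ p }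

/-- The first Dirichlet eigenvalue of the `p`-Laplacian on `U`:
`λ₁(U) = inf { (∫_U |∇φ|^p)/(∫_U |φ|^p) : φ ∈ C_c^∞(U), φ ≢ 0 }`. -/
def pLambda1 (p : ℝ) {N : ℕ} (U : Set (EuclideanSpace ℝ (Fin N))) : ℝ :=
  sInf { r : ℝ | ∃ φ, IsTestFun U φ ∧ φ ≠ 0 ∧
    r = (∫ x in U, ‖gradient φ x‖ ^ p) / (∫ x in U, |φ x| ^ p) }

/-- `f` is `C^1` on the closure of `U` (i.e. `C^1` on an open neighbourhood of it). -/
def C1OnClosure {N : ℕ} (U : Set (EuclideanSpace ℝ (Fin N)))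
    (f : EuclideanSpace ℝ (Fin N) → ℝ) : Prop :=
  ∃ W, IsOpen W ∧ closure U ⊆ W ∧ ContDiffOn ℝ 1 f W

/-- `Ω` has a smooth boundary: it is the sublevel set of a smooth function whose
differential does not vanish on the boundary. -/
def HasSmoothBoundary {N : ℕ} (Ω : Set (EuclideanSpace ℝ (Fin N))) : Prop :=
  ∃ f : EuclideanSpace ℝ (Fin N) → ℝ, ContDiff ℝ (⊤ : ℕ∞) f ∧ Ω = f ⁻¹' Set.Iio 0 ∧
    ∀ x ∈ frontier Ω, fderiv ℝ f x ≠ 0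

/-- The index of the first coordinate. -/
def firstIdx (N : ℕ) (hN : 2 ≤ N) : Fin N := ⟨0, by omega⟩

/-- The first standard basis vector `e₁`. -/
def e1v {N : ℕ} (hN : 2 ≤ N) : EuclideanSpace ℝ (Fin N) :=
  EuclideanSpace.single (firstIdx N hN) 1

/-- The domain `Ω(s) = B(0,r1) \ closure B(s e₁, r0)`. -/
def annulus {N : ℕ} (hN : 2 ≤ N) (r0 r1 s : ℝ) : Set (EuclideanSpace ℝ (Fin N)) :=
  Metric.ball (0 : EuclideanSpace ℝ (Fin N)) r1 \ closure (Metric.ball (s • e1v hN) r0)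

/-- Reflection across the hyperplane `{x₁ = s}`: `x ↦ (2s - x₁, x₂, …, x_N)`. -/
def reflectH {N : ℕ} (hN : 2 ≤ N) (s : ℝ) (x : EuclideanSpace ℝ (Fin N)) :
    EuclideanSpace ℝ (Fin N) :=
  x + (2 * (s - x (firstIdx N hN))) • e1v hN

/-- The divergence of a vector field, as the trace of its Jacobian. -/
def divergence {N : ℕ} (V : EuclideanSpace ℝ (Fin N) → EuclideanSpace ℝ (Fin N))
    (x : EuclideanSpace ℝ (Fin N)) : ℝ :=
  LinearMap.trace ℝ _ (fderiv ℝ V x : EuclideanSpace ℝ (Fin N) →ₗ[ℝ] EuclideanSpace ℝ (Fin N))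

/-- The classical `p`-Laplacian `Δ_p b = div(|∇b|^{p-2} ∇b)` at a point. -/
def pLapAt (p : ℝ) {N : ℕ} (b : EuclideanSpace ℝ (Fin N) → ℝ)
    (x : EuclideanSpace ℝ (Fin N)) : ℝ :=
  divergence (fun z => ‖gradient b z‖ ^ (p - 2) • gradient b z) x

/-- The torsion function of `U`: `C^1` up to the boundary, vanishing on the boundary,
positive inside, weak solution of `-Δ_p y = 1`. -/
def IsTorsionFn (p : ℝ) {N : ℕ} (U : Set (EuclideanSpace ℝ (Fin N)))
    (y : EuclideanSpace ℝ (Fin N) → ℝ) : Prop :=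
  C1OnClosure U y ∧ (∀ x ∈ frontier U, y x = 0) ∧ (∀ x ∈ U, 0 < y x) ∧
    IsWeakSolution p U y (fun _ => 1)

/-- A first eigenfunction of the Dirichlet `p`-Laplacian on `U`: `C^1` up to the boundary,
positive inside, vanishing on the boundary, `L^p`-normalized, weak solution of
`-Δ_p u = λ₁(U) u^{p-1}`. -/
def IsFirstEigenfun (p : ℝ) {N : ℕ} (U : Set (EuclideanSpace ℝ (Fin N)))
    (y : EuclideanSpace ℝ (Fin N) → ℝ) : Prop :=
  C1OnClosure U y ∧ (∀ x ∈ U, 0 < y x) ∧ (∀ x ∈ frontier U, y x = 0) ∧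
    (∫ x in U, y x ^ p) = 1 ∧
    IsWeakSolution p U y (fun x => pLambda1 p U * y x ^ (p - 1))

/-- The matrix `DA(x) = |x|^{p-2} I + (p-2)|x|^{p-4} x xᵀ`,
the derivative of `A(x) = |x|^{p-2} x`. -/
def DA (p : ℝ) {N : ℕ} (x : EuclideanSpace ℝ (Fin N)) :
    EuclideanSpace ℝ (Fin N) →L[ℝ] EuclideanSpace ℝ (Fin N) :=
  ‖x‖ ^ (p - 2) • ContinuousLinearMap.id ℝ (EuclideanSpace ℝ (Fin N)) +
    ((p - 2) * ‖x‖ ^ (p - 4)) • (innerSL ℝ x).smulRight x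

/-- `w` is a nonnegative bounded weak solution, continuous on the closure of `Ω` and `C^1`
inside, of `-Δ_p w = F(x, w)` in `Ω` with boundary value `bdry` on `∂Ω`. -/
def SolClass (p : ℝ) {N : ℕ} (Ω : Set (EuclideanSpace ℝ (Fin N)))
    (F : EuclideanSpace ℝ (Fin N) → ℝ → ℝ)
    (bdry w : EuclideanSpace ℝ (Fin N) → ℝ) : Prop :=
  ContinuousOn w (closure Ω) ∧ ContDiffOn ℝ 1 w Ω ∧
    (∀ x ∈ closure Ω, 0 ≤ w x) ∧ (∃ M, ∀ x ∈ closure Ω, |w x| ≤ M) ∧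
    IsWeakSolution p Ω w (fun x => F x (w x)) ∧ (∀ x ∈ frontier Ω, w x = bdry x)

section HopfLemma

open Filter Topology

/-- The vector field `a ↦ |a|^{p-2} a` underlying the `p`-Laplacian. -/
def pFlux (p : ℝ) {E : Type*} [NormedAddCommGroup E] [InnerProductSpace ℝ E] (a : E) : E :=
  ‖a‖ ^ (p - 2) • a

section Flux

variable {E : Type*} [NormedAddCommGroup E] [InnerProductSpace ℝ E] {p : ℝ}

lemma norm_pFlux (hp : 1 < p) (a : E) : ‖pFlux p a‖ = ‖a‖ ^ (p - 1) := by
  rcases eq_or_ne a 0 with rfl | ha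
  · simp [pFlux, Real.zero_rpow (by linarith : p - 1 ≠ 0)]
  · have : 0 < ‖a‖ := norm_pos_iff.2 ha
    rw [pFlux, norm_smul, Real.norm_of_nonneg (by positivity), ← Real.rpow_add_one this.ne']
    ring_nf

lemma continuous_pFlux (hp : 1 < p) : Continuous (pFlux p : E → E) := by
  rw [continuous_iff_continuousAt]
  intro a
  rcases eq_or_ne a 0 with rfl | ha
  · have h0 : pFlux p (0 : E) = 0 := by simp [pFlux]
    rw [ContinuousAt, h0, tendsto_zero_iff_norm_tendsto_zero]
    simp_rw [norm_pFlux hp]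
    have : ContinuousAt (fun a : E => ‖a‖ ^ (p - 1)) 0 :=
      continuous_norm.continuousAt.rpow_const (Or.inr (by linarith))
    simpa [ContinuousAt, Real.zero_rpow (by linarith : p - 1 ≠ 0)] using this
  · exact (continuous_norm.continuousAt.rpow_const (Or.inl (norm_ne_zero_iff.2 ha))).smul
      continuousAt_id

lemma inner_pFlux_sub_pFlux (hp : 1 < p) (a b : E) :
    ⟪pFlux p a - pFlux p b, a - b⟫ =
      (‖a‖ ^ (p - 1) - ‖b‖ ^ (p - 1)) * (‖a‖ - ‖b‖) +
        (‖a‖ ^ (p - 2) + ‖b‖ ^ (p - 2)) * (‖a‖ * ‖b‖ - ⟪a, b⟫) := by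
  have key : ∀ c : E, ‖c‖ ^ (p - 1) = ‖c‖ ^ (p - 2) * ‖c‖ := fun c => by
    rw [← norm_pFlux hp, pFlux, norm_smul, Real.norm_of_nonneg (by positivity)]
  simp only [pFlux, inner_sub_left, inner_sub_right, real_inner_smul_left,
    real_inner_self_eq_norm_sq, key, real_inner_comm a b]
  ring

lemma rpow_sub_mul_sub_nonneg {q s t : ℝ} (hq : 0 < q) (hs : 0 ≤ s) (ht : 0 ≤ t) :
    0 ≤ (s ^ q - t ^ q) * (s - t) := by
  rcases le_total s t with h | h
  · exact mul_nonneg_of_nonpos_of_nonpos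
      (sub_nonpos.2 (Real.rpow_le_rpow hs h hq.le)) (sub_nonpos.2 h)
  · exact mul_nonneg (sub_nonneg.2 (Real.rpow_le_rpow ht h hq.le)) (sub_nonneg.2 h)

lemma inner_pFlux_sub_pFlux_nonneg (hp : 1 < p) (a b : E) :
    0 ≤ ⟪pFlux p a - pFlux p b, a - b⟫ := by
  rw [inner_pFlux_sub_pFlux hp]
  exact add_nonneg
    (rpow_sub_mul_sub_nonneg (sub_pos.2 hp) (norm_nonneg a) (norm_nonneg b))
    (mul_nonneg (by positivity) (sub_nonneg.2 (real_inner_le_norm a b)))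

lemma eq_of_inner_pFlux_sub_pFlux_eq_zero (hp : 1 < p) {a b : E}
    (h : ⟪pFlux p a - pFlux p b, a - b⟫ = 0) : a = b := by
  rw [inner_pFlux_sub_pFlux hp] at h
  have h1 := rpow_sub_mul_sub_nonneg (sub_pos.2 hp) (norm_nonneg a) (norm_nonneg b)
  have h2 : 0 ≤ (‖a‖ ^ (p - 2) + ‖b‖ ^ (p - 2)) * (‖a‖ * ‖b‖ - ⟪a, b⟫) :=
    mul_nonneg (by positivity) (sub_nonneg.2 (real_inner_le_norm a b))
  have hnorm : ‖a‖ = ‖b‖ := by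
    rcases mul_eq_zero.1 (le_antisymm (by linarith) h1) with h3 | h3
    · exact (Real.rpow_left_inj (norm_nonneg a) (norm_nonneg b) (by linarith)).1
        (sub_eq_zero.1 h3)
    · exact sub_eq_zero.1 h3
  rcases eq_or_ne a 0 with rfl | ha
  · exact (norm_eq_zero.1 (by rw [← hnorm, norm_zero])).symm
  · have hpos : 0 < ‖a‖ := norm_pos_iff.2 ha
    have h4 : ‖a‖ * ‖b‖ - ⟪a, b⟫ = 0 := by
      refine (mul_eq_zero.1 (le_antisymm (by linarith) h2)).resolve_left ?_
      have := Real.rpow_pos_of_pos hpos (p - 2)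
      positivity
    have h5 : ‖a - b‖ ^ 2 = 0 := by
      rw [norm_sub_sq_real, ← hnorm]
      rw [← hnorm] at h4
      linarith
    exact sub_eq_zero.1 (norm_eq_zero.1 (pow_eq_zero_iff two_ne_zero |>.1 h5))

end Flux

section Calculus

variable {E : Type*} [NormedAddCommGroup E] [InnerProductSpace ℝ E]

lemma fderiv_eq_zero_of_notMem_tsupport {φ : E → ℝ} {x : E} (hx : x ∉ tsupport φ) :
    fderiv ℝ φ x = 0 :=
  Function.notMem_support.1 fun h => hx (support_fderiv_subset ℝ h)

lemma hasFDerivAt_norm_sub_sq_rpow (s : ℝ) {x z : E} (hx : x ≠ z) :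
    HasFDerivAt (fun x => (‖x - z‖ ^ 2) ^ s)
      ((2 * s * (‖x - z‖ ^ 2) ^ (s - 1)) • innerSL ℝ (x - z)) x := by
  have h1 : HasFDerivAt (fun x => ‖x - z‖ ^ 2) (2 • innerSL ℝ (x - z)) x := by
    simpa using! ((hasFDerivAt_id x).sub_const z).norm_sq
  have h2 : ‖x - z‖ ^ 2 ≠ 0 := pow_ne_zero 2 (norm_ne_zero_iff.2 (sub_ne_zero.2 hx))
  convert h1.rpow_const (p := s) (Or.inl h2) using 1
  ext v
  simp
  ring

lemma contDiffAt_norm_sub_sq_rpow (s : ℝ) {x z : E} (hx : x ≠ z) :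
    ContDiffAt ℝ 1 (fun x => (‖x - z‖ ^ 2) ^ s) x :=
  ((contDiffAt_id.sub contDiffAt_const).norm_sq ℝ).rpow_const_of_ne
    (pow_ne_zero 2 (norm_ne_zero_iff.2 (sub_ne_zero.2 hx)))

lemma ContDiffOn.continuousOn_gradient [CompleteSpace E] {U : Set E} (hU : IsOpen U) {u : E → ℝ}
    (hu : ContDiffOn ℝ 1 u U) : ContinuousOn (gradient u) U :=
  (InnerProductSpace.toDual ℝ E).symm.continuous.comp_continuousOn
    (hu.continuousOn_fderiv_of_isOpen hU le_rfl)

end Calculus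

section Mollification

variable {E : Type*} [NormedAddCommGroup E] [InnerProductSpace ℝ E] [FiniteDimensional ℝ E]
  [MeasurableSpace E] [BorelSpace E]

open scoped Convolution Pointwise in
/-- A `C^1_c` function on an open set is a `C^1` limit of smooth test functions whose gradients are
uniformly bounded and which live in a fixed compact set. -/
lemma exists_seq_contDiff_tendsto_fderiv {U : Set E} (hU : IsOpen U) {φ : E → ℝ}
    (hφ : ContDiff ℝ 1 φ) (hc : HasCompactSupport φ) (hs : tsupport φ ⊆ U) (h0 : ∀ x, 0 ≤ φ x) :
    ∃ (K : Set E) (M : ℝ) (ψ : ℕ → E → ℝ), IsCompact K ∧ K ⊆ U ∧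
      (∀ n, ContDiff ℝ (⊤ : ℕ∞) (ψ n) ∧ tsupport (ψ n) ⊆ K ∧ ∀ x, 0 ≤ ψ n x) ∧
      (∀ n x, ‖fderiv ℝ (ψ n) x‖ ≤ M) ∧
      ∀ x, Tendsto (fun n => fderiv ℝ (ψ n) x) atTop (𝓝 (fderiv ℝ φ x)) := by
  obtain ⟨δ, hδ, hδU⟩ := hc.isCompact.exists_cthickening_subset_open hU hs
  have hdc : Continuous (fderiv ℝ φ) := hφ.continuous_fderiv one_ne_zero
  obtain ⟨M, hM⟩ := (hc.fderiv (𝕜 := ℝ)).exists_bound_of_continuous hdc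
  let b : ℕ → ContDiffBump (0 : E) := fun n =>
    ⟨δ / 2 / (n + 1), δ / (n + 1), by positivity, by gcongr; linarith⟩
  have hb : Tendsto (fun n => (b n).rOut) atTop (𝓝 0) :=
    tendsto_const_div_atTop_nhds_zero_nat δ |>.comp (tendsto_add_atTop_nat 1) |>.congr
      fun n => by simp [b]
  have hbδ : ∀ n, (b n).rOut ≤ δ := fun n =>
    div_le_self hδ.le (by linarith [(Nat.cast_nonneg n : (0 : ℝ) ≤ n)])
  let ψ : ℕ → E → ℝ := fun n => (b n).normed volume ⋆[ContinuousLinearMap.lsmul ℝ ℝ, volume] φ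
  have hli : LocallyIntegrable φ volume := hφ.continuous.locallyIntegrable
  have hfd : ∀ n x, fderiv ℝ (ψ n) x =
      ((b n).normed volume ⋆[ContinuousLinearMap.lsmul ℝ ℝ, volume] fderiv ℝ φ) x := fun n x =>
    (hc.hasFDerivAt_convolution_right _ ((b n).continuous_normed.locallyIntegrable) hφ x).fderiv
  refine ⟨cthickening δ (tsupport φ), 2 * M + M, ψ, hc.isCompact.cthickening, hδU,
    fun n => ⟨(b n).hasCompactSupport_normed.contDiff_convolution_left _ (b n).contDiff_normed hli,
      ?_, fun x => ?_⟩, fun n x => ?_, fun x => ?_⟩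
  · refine closure_minimal ?_ isClosed_cthickening
    refine (support_convolution_subset _).trans ?_
    rw [(b n).support_normed_eq]
    rintro _ ⟨u, hu, v, hv, rfl⟩
    refine mem_cthickening_of_dist_le _ v δ _ (subset_tsupport _ hv) ?_
    have : ‖u‖ < (b n).rOut := by simpa using hu
    simpa [dist_eq_norm] using this.le.trans (hbδ n)
  · exact integral_nonneg fun t => mul_nonneg ((b n).nonneg_normed t) (h0 _)
  · have h := (b n).dist_normed_convolution_le (μ := volume) (g := fderiv ℝ φ) (x₀ := x)
      (ε := 2 * M) hdc.aestronglyMeasurable fun z _ => by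
        rw [dist_eq_norm]
        exact (norm_sub_le _ _).trans (by linarith [hM z, hM x])
    rw [← hfd, dist_eq_norm] at h
    calc ‖fderiv ℝ (ψ n) x‖ = ‖(fderiv ℝ (ψ n) x - fderiv ℝ φ x) + fderiv ℝ φ x‖ := by simp
      _ ≤ 2 * M + M := (norm_add_le _ _).trans (add_le_add h (hM x))
  · simp_rw [hfd]
    exact ContDiffBump.convolution_tendsto_right_of_continuous hb hdc x

/-- A distributional inequality `-div F ≥ 0` tested against smooth functions may be tested against
`C^1` functions. -/
lemma setIntegral_fderiv_nonneg_of_contDiff_one {U : Set E} (hU : IsOpen U) {F : E → E}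
    (hF : ContinuousOn F U)
    (hweak : ∀ φ : E → ℝ, ContDiff ℝ (⊤ : ℕ∞) φ → HasCompactSupport φ → tsupport φ ⊆ U →
      (∀ x, 0 ≤ φ x) → 0 ≤ ∫ x in U, fderiv ℝ φ x (F x))
    {φ : E → ℝ} (hφ : ContDiff ℝ 1 φ) (hc : HasCompactSupport φ) (hs : tsupport φ ⊆ U)
    (h0 : ∀ x, 0 ≤ φ x) : 0 ≤ ∫ x in U, fderiv ℝ φ x (F x) := by
  obtain ⟨K, M, ψ, hK, hKU, hψ, hM, hlim⟩ := exists_seq_contDiff_tendsto_fderiv hU hφ hc hs h0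
  obtain ⟨B, hB⟩ := hK.exists_bound_of_continuousOn (hF.mono hKU)
  have hM0 : 0 ≤ M := (norm_nonneg _).trans (hM 0 0)
  have htend : Tendsto (fun n => ∫ x in U, fderiv ℝ (ψ n) x (F x)) atTop
      (𝓝 (∫ x in U, fderiv ℝ φ x (F x))) := by
    refine tendsto_integral_of_dominated_convergence (K.indicator fun _ => M * B) (fun n => ?_) ?_
      (fun n => Eventually.of_forall fun x => ?_) (Eventually.of_forall fun x => ?_)
    · have hcont : Continuous (fderiv ℝ (ψ n)) := (hψ n).1.continuous_fderiv (by simp)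
      exact (hcont.continuousOn.clm_apply hF).aestronglyMeasurable hU.measurableSet
    · exact ((integrable_indicator_iff hK.measurableSet).2
        (integrableOn_const hK.measure_lt_top.ne)).restrict
    · by_cases hx : x ∈ K
      · rw [indicator_of_mem hx]
        exact (ContinuousLinearMap.le_opNorm _ _).trans
          (mul_le_mul (hM n x) (hB x hx) (norm_nonneg _) hM0)
      · rw [indicator_of_notMem hx,
          fderiv_eq_zero_of_notMem_tsupport fun h => hx ((hψ n).2.1 h)]
        simp
    · exact ((ContinuousLinearMap.apply ℝ ℝ (F x)).continuous.tendsto _).comp (hlim x)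
  exact ge_of_tendsto' htend fun n => hweak _ (hψ n).1
    (hK.of_isClosed_subset (isClosed_tsupport _) (hψ n).2.1) ((hψ n).2.1.trans hKU) (hψ n).2.2

lemma integrableOn_fderiv_apply {U : Set E} {F : E → E} (hF : ContinuousOn F U) {φ : E → ℝ}
    (hφ : ContDiff ℝ 1 φ) (hc : HasCompactSupport φ) (hs : tsupport φ ⊆ U) :
    IntegrableOn (fun x => fderiv ℝ φ x (F x)) U := by
  have hcont : ContinuousOn (fun x => fderiv ℝ φ x (F x)) (tsupport φ) :=
    (hφ.continuous_fderiv one_ne_zero).continuousOn.clm_apply (hF.mono hs)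
  exact ((hcont.integrableOn_compact hc).integrable_of_forall_notMem_eq_zero fun x hx => by
    rw [fderiv_eq_zero_of_notMem_tsupport hx, zero_apply]).integrableOn

end Mollification

section RadialBarrier

variable {E : Type*} [NormedAddCommGroup E] [InnerProductSpace ℝ E] [FiniteDimensional ℝ E]
  [MeasurableSpace E] [BorelSpace E]

lemma integral_fderiv_sub_eq_neg_finrank_mul {g : E → ℝ} (hg : ContDiff ℝ 1 g)
    (hc : HasCompactSupport g) (z : E) :
    ∫ x, fderiv ℝ g x (x - z) = -(Module.finrank ℝ E * ∫ x, g x) := by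
  let b := stdOrthonormalBasis ℝ E
  have hd : Continuous (fderiv ℝ g) := hg.continuous_fderiv one_ne_zero
  have hdi : ∀ i x, HasFDerivAt (fun x => ⟪b i, x - z⟫) (innerSL ℝ (b i)) x := fun i x => by
    simpa using! ((innerSL ℝ (b i)).hasFDerivAt (x := x - z)).comp x
      ((hasFDerivAt_id x).sub_const z)
  have hint : ∀ i, Integrable fun x => ⟪b i, x - z⟫ * fderiv ℝ g x (b i) := fun i =>
    Continuous.integrable_of_hasCompactSupport (by fun_prop)
      ((hc.fderiv_apply (𝕜 := ℝ) (b i)).mul_left)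
  have hcoord : ∀ i, ∫ x, ⟪b i, x - z⟫ * fderiv ℝ g x (b i) = -∫ x, g x := fun i => by
    have hone : ∀ x, fderiv ℝ (fun x => ⟪b i, x - z⟫) x (b i) = 1 := fun x => by
      rw [(hdi i x).fderiv]; simp
    rw [integral_mul_fderiv_eq_neg_fderiv_mul_of_integrable]
    · simp_rw [hone, one_mul]
    · simp_rw [hone, one_mul]
      exact hg.continuous.integrable_of_hasCompactSupport hc
    · exact hint i
    · exact Continuous.integrable_of_hasCompactSupport (by fun_prop) hc.mul_left
    · exact fun x _ => (hdi i x).differentiableAt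
    · exact fun x _ => hg.differentiable one_ne_zero x
  have hsum : ∀ x, fderiv ℝ g x (x - z) = ∑ i, ⟪b i, x - z⟫ * fderiv ℝ g x (b i) := fun x => by
    conv_lhs => rw [← b.sum_repr' (x - z)]
    simp
  simp_rw [hsum]
  rw [integral_finsetSum _ fun i _ => hint i]
  simp [hcoord]

/-- The field `|x - z|^{-2β} (x - z)` has nonpositive divergence away from `z` when
`2β ≥ dim E`. -/
lemma integral_fderiv_radial_nonneg {β : ℝ} (hβ : (Module.finrank ℝ E : ℝ) ≤ 2 * β) {z : E}
    {φ : E → ℝ} (hφ : ContDiff ℝ 1 φ) (hc : HasCompactSupport φ) (hz : z ∉ tsupport φ)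
    (h0 : ∀ x, 0 ≤ φ x) :
    0 ≤ ∫ x, fderiv ℝ φ x ((‖x - z‖ ^ 2) ^ (-β) • (x - z)) := by
  let g : E → ℝ := fun x => φ x * (‖x - z‖ ^ 2) ^ (-β)
  have hgc : HasCompactSupport g := hc.mul_right
  have hg : ContDiff ℝ 1 g := by
    rw [contDiff_iff_contDiffAt]
    intro x
    rcases eq_or_ne x z with rfl | hx
    · refine contDiffAt_const (c := (0 : ℝ)) |>.congr_of_eventuallyEq ?_
      filter_upwards [notMem_tsupport_iff_eventuallyEq.1 hz] with x hx
      simp [g, hx]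
    · exact hφ.contDiffAt.mul (contDiffAt_norm_sub_sq_rpow _ hx)
  have hpt : ∀ x, fderiv ℝ φ x ((‖x - z‖ ^ 2) ^ (-β) • (x - z)) =
      fderiv ℝ g x (x - z) + 2 * β * g x := fun x => by
    rcases eq_or_ne x z with rfl | hx
    · have : φ x = 0 := image_eq_zero_of_notMem_tsupport hz
      simp [g, this]
    · have hpos : 0 < ‖x - z‖ ^ 2 := by
        have := norm_pos_iff.2 (sub_ne_zero.2 hx)
        positivity
      have hd := ((hφ.differentiable one_ne_zero x).hasFDerivAt.mul
        (hasFDerivAt_norm_sub_sq_rpow (-β) hx)).fderiv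
      have hd' : fderiv ℝ g x = _ := hd
      have hr : (‖x - z‖ ^ 2) ^ (-β) = (‖x - z‖ ^ 2) ^ (-β - 1) * ‖x - z‖ ^ 2 := by
        rw [← Real.rpow_add_one hpos.ne']
        ring_nf
      rw [hd']
      simp only [map_smul, smul_eq_mul, add_apply,
        smul_apply, innerSL_apply_apply, real_inner_self_eq_norm_sq, g]
      rw [hr]
      ring
  simp_rw [hpt]
  rw [integral_add, integral_const_mul, integral_fderiv_sub_eq_neg_finrank_mul hg hgc]
  · have : 0 ≤ ∫ x, g x := integral_nonneg fun x => mul_nonneg (h0 x) (by positivity)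
    nlinarith
  · have hd : Continuous (fderiv ℝ g) := hg.continuous_fderiv one_ne_zero
    refine Continuous.integrable_of_hasCompactSupport (by fun_prop)
      ((hgc.fderiv (𝕜 := ℝ)).mono fun x hx => ?_)
    contrapose! hx
    simp [Function.notMem_support.1 hx]
  · exact (hg.continuous.integrable_of_hasCompactSupport hgc).const_mul _

end RadialBarrier

section Comparison

lemma hasDerivAt_max_zero_sq (t : ℝ) :
    HasDerivAt (fun t : ℝ => max t 0 ^ 2) (2 * max t 0) t := by
  rcases lt_trichotomy t 0 with ht | rfl | ht
  · rw [max_eq_right ht.le, mul_zero]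
    refine (hasDerivAt_const t (0 : ℝ)).congr_of_eventuallyEq ?_
    filter_upwards [eventually_lt_nhds ht] with s hs
    simp [max_eq_right hs.le]
  · rw [max_self, mul_zero, hasDerivAt_iff_isLittleO]
    refine Asymptotics.IsBigO.trans_isLittleO (g := fun s : ℝ => s ^ 2)
      (Asymptotics.IsBigO.of_bound 1 (Eventually.of_forall fun s => ?_)) ?_
    · rcases le_total s 0 with hs | hs
      · simp [max_eq_right hs, sq_nonneg]
      · simp [max_eq_left hs]
    · simpa using Asymptotics.isLittleO_pow_id (𝕜 := ℝ) one_lt_two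
  · rw [max_eq_left ht.le]
    have h := hasDerivAt_pow 2 t
    simp only [Nat.cast_ofNat, Nat.add_one_sub_one, pow_one] at h
    refine h.congr_of_eventuallyEq ?_
    filter_upwards [eventually_gt_nhds ht] with s hs
    simp [max_eq_left hs.le]

lemma contDiff_max_zero_sq : ContDiff ℝ 1 (fun t : ℝ => max t 0 ^ 2) := by
  rw [contDiff_one_iff_deriv]
  refine ⟨fun t => (hasDerivAt_max_zero_sq t).differentiableAt, ?_⟩
  rw [funext fun t => (hasDerivAt_max_zero_sq t).deriv]
  fun_prop

variable {E : Type*} [NormedAddCommGroup E] [InnerProductSpace ℝ E] [FiniteDimensional ℝ E]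
  [MeasurableSpace E] [BorelSpace E] {p : ℝ}

/-- Weak comparison principle for the `p`-Laplacian: if `-Δ_p v ≤ -Δ_p u` in `U` and `v ≤ u` on the
boundary, then `v ≤ u` in `U`. -/
theorem le_of_pLaplacian_le [Nontrivial E] (hp : 1 < p) {U : Set E} (hU : IsOpen U)
    (hb : Bornology.IsBounded U) {u v : E → ℝ}
    (huc : ContinuousOn u (closure U)) (hvc : ContinuousOn v (closure U))
    (hu : ContDiffOn ℝ 1 u U) (hv : ContDiffOn ℝ 1 v U) (hbd : ∀ x ∈ frontier U, v x ≤ u x)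
    (hweak : ∀ φ : E → ℝ, ContDiff ℝ (⊤ : ℕ∞) φ → HasCompactSupport φ → tsupport φ ⊆ U →
      (∀ x, 0 ≤ φ x) →
      0 ≤ ∫ x in U, fderiv ℝ φ x (pFlux p (gradient u x) - pFlux p (gradient v x))) :
    ∀ x ∈ U, v x ≤ u x := by
  by_contra! hcon
  obtain ⟨x₁, hx₁, hlt⟩ := hcon
  obtain ⟨δ, hδ, hδ₁⟩ : ∃ δ : ℝ, 0 < δ ∧ δ < v x₁ - u x₁ := exists_between (sub_pos.2 hlt)
  let w : E → ℝ := fun x => v x - u x - δ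
  let φ : E → ℝ := U.indicator fun x => max (w x) 0 ^ 2
  let S : Set E := closure U ∩ w ⁻¹' Ici 0
  have hwc : ContinuousOn w (closure U) := (hvc.sub huc).sub continuousOn_const
  have hScl : IsClosed S := hwc.preimage_isClosed_of_isClosed isClosed_closure isClosed_Ici
  have hS : IsCompact S := hb.isCompact_closure.of_isClosed_subset hScl inter_subset_left
  have hSU : S ⊆ U := fun x hx => by
    by_contra hxU
    have h1 := hbd x ⟨hx.1, by rwa [hU.interior_eq]⟩
    have h2 : 0 ≤ v x - u x - δ := hx.2
    linarith
  have hφS : ∀ x ∉ S, φ x = 0 := fun x hx => by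
    by_cases hxU : x ∈ U
    · have : w x < 0 := not_le.1 fun h => hx ⟨subset_closure hxU, h⟩
      simp [φ, hxU, max_eq_right this.le]
    · simp [φ, hxU]
  have hts : tsupport φ ⊆ S :=
    closure_minimal (fun x hx => by_contra fun h => hx (hφS x h)) hScl
  have hφc : HasCompactSupport φ := hS.of_isClosed_subset (isClosed_tsupport _) hts
  have hφeq : ∀ x ∈ U, φ =ᶠ[𝓝 x] fun x => max (w x) 0 ^ 2 := fun x hx => by
    filter_upwards [hU.mem_nhds hx] with z hz
    simp [φ, hz]
  have hφ1 : ContDiff ℝ 1 φ := by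
    rw [contDiff_iff_contDiffAt]
    intro x
    by_cases hx : x ∈ U
    · have hw : ContDiffAt ℝ 1 w x := ((hv.contDiffAt (hU.mem_nhds hx)).sub
        (hu.contDiffAt (hU.mem_nhds hx))).sub contDiffAt_const
      exact (contDiff_max_zero_sq.contDiffAt.comp x hw).congr_of_eventuallyEq (hφeq x hx)
    · exact contDiffAt_const (c := (0 : ℝ)) |>.congr_of_eventuallyEq
        (notMem_tsupport_iff_eventuallyEq.1 fun h => hx (hSU (hts h)))
  have hfd : ∀ x ∈ U, fderiv ℝ φ x = (2 * max (w x) 0) • (fderiv ℝ v x - fderiv ℝ u x) := by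
    intro x hx
    have hdu := ((hu.contDiffAt (hU.mem_nhds hx)).differentiableAt one_ne_zero).hasFDerivAt
    have hdv := ((hv.contDiffAt (hU.mem_nhds hx)).differentiableAt one_ne_zero).hasFDerivAt
    rw [(hφeq x hx).fderiv_eq]
    exact ((hasDerivAt_max_zero_sq (w x)).comp_hasFDerivAt x ((hdv.sub hdu).sub_const δ)).fderiv
  let G : E → E := fun x => pFlux p (gradient u x) - pFlux p (gradient v x)
  have hG : ContinuousOn G U :=
    ((continuous_pFlux hp).comp_continuousOn (hu.continuousOn_gradient hU)).sub
      ((continuous_pFlux hp).comp_continuousOn (hv.continuousOn_gradient hU))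
  have hpt : ∀ x ∈ U, fderiv ℝ φ x (G x) =
      -(2 * max (w x) 0 * ⟪G x, gradient u x - gradient v x⟫) := fun x hx => by
    rw [hfd x hx, ← neg_sub (gradient v x) (gradient u x), inner_neg_right,
      real_inner_comm (gradient v x - gradient u x), inner_sub_left, inner_gradient_left,
      inner_gradient_left]
    simp only [smul_apply, sub_apply, smul_eq_mul]
    ring
  have hI : 0 ≤ ∫ x in U, fderiv ℝ φ x (G x) :=
    setIntegral_fderiv_nonneg_of_contDiff_one hU hG hweak hφ1 hφc (hts.trans hSU) fun x =>
      indicator_nonneg (fun _ _ => sq_nonneg _) x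
  have hle : ∀ x ∈ U, fderiv ℝ φ x (G x) ≤ 0 := fun x hx => by
    rw [hpt x hx, neg_nonpos]
    exact mul_nonneg (by positivity) (inner_pFlux_sub_pFlux_nonneg hp _ _)
  have hcont : ContinuousOn (fun x => fderiv ℝ φ x (G x)) U :=
    (hφ1.continuous_fderiv one_ne_zero).continuousOn.clm_apply hG
  have hint := integrableOn_fderiv_apply hG hφ1 hφc (hts.trans hSU)
  have hzero : EqOn (fun x => fderiv ℝ φ x (G x)) (fun _ => 0) U := by
    refine Measure.eqOn_open_of_ae_eq (μ := volume) ?_ hU hcont continuousOn_const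
    have h1 : ∫ x in U, -fderiv ℝ φ x (G x) = 0 := by
      rw [integral_neg, neg_eq_zero]
      exact le_antisymm (setIntegral_nonpos hU.measurableSet hle) hI
    have h2 := (setIntegral_eq_zero_iff_of_nonneg_ae ((ae_restrict_iff' hU.measurableSet).2
      (Eventually.of_forall fun x hx => neg_nonneg.2 (hle x hx))) hint.neg).1 h1
    filter_upwards [h2] with x hx
    exact neg_eq_zero.1 hx
  have hfd0 : ∀ x, fderiv ℝ φ x = 0 := fun x => by
    by_cases hx : x ∈ U
    · have h1 : fderiv ℝ φ x (G x) = 0 := hzero hx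
      rw [hpt x hx, neg_eq_zero, mul_eq_zero] at h1
      rw [hfd x hx]
      rcases h1 with h1 | h1
      · rw [h1, zero_smul]
      · have h2 := eq_of_inner_pFlux_sub_pFlux_eq_zero hp h1
        rw [← toDual_gradient, ← toDual_gradient, h2, sub_self, smul_zero]
    · exact fderiv_eq_zero_of_notMem_tsupport fun h => hx (hSU (hts h))
  obtain ⟨x₂, hx₂⟩ : ∃ x, x ∉ U := by
    by_contra! h
    exact NormedSpace.unbounded_univ ℝ E (by rwa [← eq_univ_of_forall h])
  have h12 := is_const_of_fderiv_eq_zero (hφ1.differentiable one_ne_zero) hfd0 x₁ x₂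
  have hw₁ : 0 < w x₁ := sub_pos.2 hδ₁
  simp only [φ, indicator_of_mem hx₁, indicator_of_notMem hx₂, max_eq_left hw₁.le] at h12
  exact (pow_pos hw₁ 2).ne' h12

end Comparison

section Barrier

variable {E : Type*} [NormedAddCommGroup E] [InnerProductSpace ℝ E]

/-- The radial barrier `c (|x - z|^{-2s} - R^{-2s})`. -/
def radialBarrier (c s R : ℝ) (z x : E) : ℝ := c * ((‖x - z‖ ^ 2) ^ (-s) - (R ^ 2) ^ (-s))

lemma contDiffAt_radialBarrier (c s R : ℝ) {x z : E} (hx : x ≠ z) :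
    ContDiffAt ℝ 1 (radialBarrier c s R z) x :=
  contDiffAt_const.mul ((contDiffAt_norm_sub_sq_rpow _ hx).sub contDiffAt_const)

lemma hasGradientAt_radialBarrier [CompleteSpace E] (c s R : ℝ) {x z : E} (hx : x ≠ z) :
    HasGradientAt (radialBarrier c s R z)
      (-((2 * c * s * (‖x - z‖ ^ 2) ^ (-s - 1)) • (x - z))) x := by
  rw [hasGradientAt_iff_hasFDerivAt]
  convert! ((hasFDerivAt_norm_sub_sq_rpow (-s) hx).sub_const ((R ^ 2) ^ (-s))).const_mul c using 1
  ext v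
  simp
  ring

lemma pFlux_neg_smul (p : ℝ) {k : ℝ} (hk : 0 < k) (a : E) :
    pFlux p (-(k • a)) = -((k ^ (p - 1) * ‖a‖ ^ (p - 2)) • a) := by
  have h : k ^ (p - 1) = k ^ (p - 2) * k := by
    rw [← Real.rpow_add_one hk.ne']
    ring_nf
  rw [pFlux, norm_neg, norm_smul, Real.norm_of_nonneg hk.le,
    Real.mul_rpow hk.le (norm_nonneg a), smul_neg, smul_smul, h]
  ring_nf

lemma pFlux_gradient_radialBarrier [CompleteSpace E] (p : ℝ) {c s : ℝ} (hc : 0 < c) (hs : 0 < s)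
    (R : ℝ) {x z : E} (hx : x ≠ z) :
    pFlux p (gradient (radialBarrier c s R z) x) =
      -((2 * c * s) ^ (p - 1) • (‖x - z‖ ^ 2) ^ (-(s * (p - 1) + p / 2)) • (x - z)) := by
  have hn : 0 < ‖x - z‖ := norm_pos_iff.2 (sub_ne_zero.2 hx)
  rw [(hasGradientAt_radialBarrier c s R hx).gradient, pFlux_neg_smul p (by positivity),
    Real.mul_rpow (by positivity) (by positivity), smul_smul, mul_assoc,
    ← Real.rpow_natCast, ← Real.rpow_mul hn.le, ← Real.rpow_mul hn.le, ← Real.rpow_mul hn.le,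
    ← Real.rpow_add hn]
  congr 4
  push_cast
  ring

/-- The radial barrier is a weak subsolution of the `p`-Laplace equation away from its pole when
`s (p - 1)` is at least the dimension. -/
lemma setIntegral_fderiv_pFlux_radialBarrier_nonpos [FiniteDimensional ℝ E] [MeasurableSpace E]
    [BorelSpace E] {p : ℝ} (hp : 1 < p) {c s : ℝ} (hc : 0 < c) (hs : 0 < s)
    (hsp : (Module.finrank ℝ E : ℝ) ≤ s * (p - 1)) (R : ℝ) {U : Set E} {z : E} (hz : z ∉ U)
    {φ : E → ℝ} (hφ : ContDiff ℝ 1 φ) (hφc : HasCompactSupport φ) (hφU : tsupport φ ⊆ U)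
    (h0 : ∀ x, 0 ≤ φ x) :
    ∫ x in U, fderiv ℝ φ x (pFlux p (gradient (radialBarrier c s R z) x)) ≤ 0 := by
  have hpt : ∀ x, fderiv ℝ φ x (pFlux p (gradient (radialBarrier c s R z) x)) =
      -(2 * c * s) ^ (p - 1) *
        fderiv ℝ φ x ((‖x - z‖ ^ 2) ^ (-(s * (p - 1) + p / 2)) • (x - z)) := fun x => by
    rcases eq_or_ne x z with rfl | hx
    · simp [fderiv_eq_zero_of_notMem_tsupport fun h => hz (hφU h)]
    · rw [pFlux_gradient_radialBarrier p hc hs R hx, map_neg, map_smul, smul_eq_mul, neg_mul]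
  rw [setIntegral_eq_integral_of_forall_compl_eq_zero fun x hx => by
    rw [fderiv_eq_zero_of_notMem_tsupport fun h => hx (hφU h), zero_apply]]
  simp_rw [hpt]
  rw [integral_const_mul]
  have hnn : (Module.finrank ℝ E : ℝ) ≤ 2 * (s * (p - 1) + p / 2) := by
    have : (0 : ℝ) ≤ Module.finrank ℝ E := Nat.cast_nonneg _
    linarith
  exact mul_nonpos_of_nonpos_of_nonneg (by simp only [Left.neg_nonpos_iff]; positivity)
    (integral_fderiv_radial_nonneg hnn hφ hφc (fun h => hz (hφU h)) h0)

/-- Hopf's boundary point lemma for the `p`-Laplacian at a point of the boundary of a ball. -/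
theorem inner_gradient_neg_of_pLaplacian_nonpos [FiniteDimensional ℝ E] [MeasurableSpace E]
    [BorelSpace E] [Nontrivial E] {p : ℝ} (hp : 1 < p) {z x₀ : E} {R : ℝ} (hR : 0 < R)
    (hx₀ : x₀ ∈ sphere z R) {u : E → ℝ} (huc : ContinuousOn u (closedBall z R))
    (hu : ContDiffOn ℝ 1 u (ball z R)) (hpos : ∀ x ∈ ball z R, 0 < u x)
    (hd : DifferentiableAt ℝ u x₀) (hux₀ : u x₀ = 0)
    (hweak : ∀ φ : E → ℝ, ContDiff ℝ (⊤ : ℕ∞) φ → HasCompactSupport φ → tsupport φ ⊆ ball z R →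
      (∀ x, 0 ≤ φ x) → 0 ≤ ∫ x in ball z R, fderiv ℝ φ x (pFlux p (gradient u x))) :
    ⟪gradient u x₀, x₀ - z⟫ < 0 := by
  have hp1 : 0 < p - 1 := sub_pos.2 hp
  let s : ℝ := Module.finrank ℝ E / (p - 1)
  have hs : 0 < s := div_pos (Nat.cast_pos.2 Module.finrank_pos) hp1
  have hsp : (Module.finrank ℝ E : ℝ) ≤ s * (p - 1) := (div_mul_cancel₀ _ hp1.ne').ge
  have hhalf : sphere z (R / 2) ⊆ ball z R := fun x hx => by
    rw [mem_ball, mem_sphere.1 hx]; linarith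
  obtain ⟨m, hm, hmu⟩ := (isCompact_sphere z (R / 2)).exists_forall_le'
    (hu.continuousOn.mono hhalf) fun x hx => hpos x (hhalf hx)
  let d : ℝ := ((R / 2) ^ 2) ^ (-s) - (R ^ 2) ^ (-s)
  have hdpos : 0 < d := sub_pos.2 <| Real.rpow_lt_rpow_of_neg (by positivity)
    (by nlinarith) (neg_neg_of_pos hs)
  let c : ℝ := m / d
  have hc : 0 < c := div_pos hm hdpos
  let v : E → ℝ := radialBarrier c s R z
  have hvR : ∀ x ∈ sphere z R, v x = 0 := fun x hx => by
    simp [v, radialBarrier, mem_sphere_iff_norm.1 hx]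
  have hvhalf : ∀ x ∈ sphere z (R / 2), v x = m := fun x hx => by
    simp only [v, radialBarrier, mem_sphere_iff_norm.1 hx]
    exact div_mul_cancel₀ m hdpos.ne'
  let U : Set E := ball z R \ closedBall z (R / 2)
  have hUo : IsOpen U := isOpen_ball.sdiff isClosed_closedBall
  have hzU : z ∉ U := fun h => h.2 (mem_closedBall_self (by positivity))
  have hUcl : ∀ x ∈ closure U, R / 2 ≤ dist x z ∧ dist x z ≤ R := fun x hx => by
    have hsub : closure U ⊆ (ball z (R / 2))ᶜ ∩ closedBall z R :=
      closure_minimal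
        (fun x hx => ⟨fun h => hx.2 (ball_subset_closedBall h), ball_subset_closedBall hx.1⟩)
        (isOpen_ball.isClosed_compl.inter isClosed_closedBall)
    exact ⟨not_lt.1 (hsub hx).1, (hsub hx).2⟩
  have hne : ∀ x ∈ closure U, x ≠ z := by
    rintro x hx rfl
    have := (hUcl x hx).1
    rw [dist_self] at this
    linarith
  have hUb : closure U ⊆ closedBall z R := fun x hx => (hUcl x hx).2
  have hvU : ContDiffOn ℝ 1 v U := fun x hx =>
    (contDiffAt_radialBarrier c s R (hne x (subset_closure hx))).contDiffWithinAt
  have huU : ContDiffOn ℝ 1 u U := hu.mono sdiff_subset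
  have hcomp : ∀ x ∈ U, v x ≤ u x := by
    refine le_of_pLaplacian_le hp hUo (isBounded_ball.subset sdiff_subset) (huc.mono hUb)
      (fun x hx => (contDiffAt_radialBarrier c s R (hne x hx)).continuousAt.continuousWithinAt)
      huU hvU (fun x hx => ?_) fun φ hφ hφc hφU h0 => ?_
    · have hx' := hUcl x hx.1
      rcases hx'.2.eq_or_lt with h | h
      · rw [hvR x h]
        have hnn : closedBall z R ⊆ closedBall z R ∩ u ⁻¹' Ici 0 := by
          rw [← closure_ball z hR.ne']
          refine closure_minimal
            (fun x hx => ⟨subset_closure hx, (hpos x hx).le⟩) ?_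
          rw [closure_ball z hR.ne']
          exact huc.preimage_isClosed_of_isClosed isClosed_closedBall isClosed_Ici
        exact (hnn (hUb hx.1)).2
      · have hxs : x ∈ sphere z (R / 2) := by
          refine le_antisymm (not_lt.1 fun hlt => hx.2 ?_) hx'.1
          rw [hUo.interior_eq]
          exact ⟨h, fun h' => hlt.not_ge h'⟩
        rw [hvhalf x hxs]
        exact hmu x hxs
    · have hφ1 : ContDiff ℝ 1 φ := hφ.of_le (by exact_mod_cast le_top)
      have hφb : tsupport φ ⊆ ball z R := hφU.trans sdiff_subset
      have h1 := hweak φ hφ hφc hφb h0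
      have h2 := setIntegral_fderiv_pFlux_radialBarrier_nonpos hp hc hs hsp R hzU hφ1 hφc hφU h0
      have hzero : ∀ V : Set E, tsupport φ ⊆ V → ∀ x ∉ V,
          fderiv ℝ φ x (pFlux p (gradient u x)) = 0 := fun V hV x hx => by
        rw [fderiv_eq_zero_of_notMem_tsupport fun h => hx (hV h), zero_apply]
      rw [setIntegral_eq_integral_of_forall_compl_eq_zero (hzero _ hφb),
        ← setIntegral_eq_integral_of_forall_compl_eq_zero (hzero U hφU)] at h1
      simp_rw [map_sub]
      rw [integral_sub]
      · exact sub_nonneg.2 (h2.trans h1)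
      · exact integrableOn_fderiv_apply
          ((continuous_pFlux hp).comp_continuousOn (huU.continuousOn_gradient hUo)) hφ1 hφc hφU
      · exact integrableOn_fderiv_apply
          ((continuous_pFlux hp).comp_continuousOn (hvU.continuousOn_gradient hUo)) hφ1 hφc hφU
  have hx₀n : ‖x₀ - z‖ = R := mem_sphere_iff_norm.1 hx₀
  have hx₀z : x₀ ≠ z := by
    rintro rfl
    simp at hx₀n
    exact hR.ne hx₀n
  have hmin : IsLocalMinOn (fun x => u x - v x) (insert x₀ U) x₀ := by
    filter_upwards [self_mem_nhdsWithin] with x hx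
    rw [hux₀, hvR x₀ hx₀, sub_zero]
    rcases hx with rfl | hx
    · rw [hux₀, hvR x hx₀, sub_zero]
    · exact sub_nonneg.2 (hcomp x hx)
  have hcone : -((1 / 4 : ℝ) • (x₀ - z)) ∈ posTangentConeAt (insert x₀ U) x₀ := by
    refine mem_posTangentConeAt_of_segment_subset ?_
    rw [segment_eq_image']
    rintro _ ⟨t, ⟨ht0, ht1⟩, rfl⟩
    rcases ht0.eq_or_lt with rfl | ht0
    · simp
    · have hdist : dist (x₀ + t • (x₀ + -((1 / 4 : ℝ) • (x₀ - z)) - x₀)) z = (1 - t / 4) * R := by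
        have : x₀ + t • (x₀ + -((1 / 4 : ℝ) • (x₀ - z)) - x₀) - z = (1 - t / 4) • (x₀ - z) := by
          module
        rw [dist_eq_norm, this, norm_smul, hx₀n, Real.norm_of_nonneg (by linarith)]
      refine Or.inr ⟨?_, ?_⟩
      · rw [mem_ball, hdist]
        nlinarith
      · rw [mem_closedBall, hdist]
        nlinarith
  have hv' := hasGradientAt_radialBarrier c s R hx₀z
  have hmain := hmin.hasFDerivWithinAt_nonneg
    (hd.hasFDerivAt.sub hv'.hasFDerivAt).hasFDerivWithinAt hcone
  have hk : 0 < 2 * c * s * (‖x₀ - z‖ ^ 2) ^ (-s - 1) * ‖x₀ - z‖ ^ 2 := by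
    rw [hx₀n]; positivity
  rw [inner_gradient_left]
  simp only [sub_apply, map_neg, map_smul, smul_eq_mul, neg_apply, smul_apply,
    InnerProductSpace.toDual_apply_apply, real_inner_self_eq_norm_sq] at hmain
  linarith

end Barrier

end HopfLemma

/-- Hopf-type boundary point lemma for a first eigenfunction: if `y > 0` solves
`-Δ_p y = λ y^{p-1}` in `Ω`, `B(z0,R) ⊆ Ω` and `x0 ∈ ∂B(z0,R) ∩ ∂Ω` with `y(x0) = 0`,
then the outward normal derivative of `y` at `x0` is strictly negative. -/
theorem hopf_boundary_eigenfunction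
    (N : ℕ) (p : ℝ) (hp : 1 < p) (lam : ℝ) (hlam : 0 < lam)
    (Ω : Set (EuclideanSpace ℝ (Fin N)))
    (hΩo : IsOpen Ω) (hΩbdd : Bornology.IsBounded Ω)
    (y : EuclideanSpace ℝ (Fin N) → ℝ)
    (hy1 : C1OnClosure Ω y) (hypos : ∀ x ∈ Ω, 0 < y x)
    (hysol : IsWeakSolution p Ω y (fun x => lam * y x ^ (p - 1)))
    (z0 x0 : EuclideanSpace ℝ (Fin N)) (R : ℝ) (hR : 0 < R)
    (hball : Metric.ball z0 R ⊆ Ω)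
    (hx0 : x0 ∈ Metric.sphere z0 R ∩ frontier Ω) (hyx0 : y x0 = 0) :
    ⟪gradient y x0, R⁻¹ • (x0 - z0)⟫ < 0 := by
  obtain ⟨W, hWo, hΩW, hyW⟩ := hy1
  have hcl : closedBall z0 R ⊆ W := by
    rw [← closure_ball z0 hR.ne']
    exact (closure_mono hball).trans hΩW
  have hx0z : x0 ≠ z0 := by
    rintro rfl
    have h := mem_sphere.1 hx0.1
    rw [dist_self] at h
    exact hR.ne h
  have : Nontrivial (EuclideanSpace ℝ (Fin N)) := ⟨x0, z0, hx0z⟩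
  have hweak : ∀ φ : EuclideanSpace ℝ (Fin N) → ℝ, ContDiff ℝ (⊤ : ℕ∞) φ → HasCompactSupport φ →
      tsupport φ ⊆ ball z0 R → (∀ x, 0 ≤ φ x) →
      0 ≤ ∫ x in ball z0 R, fderiv ℝ φ x (pFlux p (gradient y x)) := fun φ hφ hφc hφU h0 => by
    have hpt : ∀ x, ‖gradient y x‖ ^ (p - 2) * ⟪gradient y x, gradient φ x⟫ =
        fderiv ℝ φ x (pFlux p (gradient y x)) := fun x => by
      rw [pFlux, map_smul, smul_eq_mul, real_inner_comm, inner_gradient_left]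
    have hzero : ∀ V : Set (EuclideanSpace ℝ (Fin N)), tsupport φ ⊆ V → ∀ x ∉ V,
        fderiv ℝ φ x (pFlux p (gradient y x)) = 0 := fun V hV x hx => by
      rw [fderiv_eq_zero_of_notMem_tsupport fun h => hx (hV h), zero_apply]
    have h := hysol φ ⟨hφ, hφc, hφU.trans hball⟩
    simp_rw [hpt] at h
    rw [setIntegral_eq_integral_of_forall_compl_eq_zero (hzero _ hφU),
      ← setIntegral_eq_integral_of_forall_compl_eq_zero (hzero _ (hφU.trans hball)), h]
    exact setIntegral_nonneg hΩo.measurableSet fun x hx =>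
      mul_nonneg (mul_nonneg hlam.le (Real.rpow_nonneg (hypos x hx).le _)) (h0 x)
  rw [real_inner_smul_right]
  exact mul_neg_of_pos_of_neg (inv_pos.2 hR) <|
    inner_gradient_neg_of_pLaplacian_nonpos hp hR hx0.1 (hyW.continuousOn.mono hcl)
      (hyW.mono (ball_subset_closedBall.trans hcl)) (fun x hx => hypos x (hball hx))
      ((hyW.contDiffAt (hWo.mem_nhds (hΩW hx0.2.1))).differentiableAt one_ne_zero) hyx0 hweak

end
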